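/- For every natural number N there exists a finite simple graph G with more than N vertices such that G is not isomorphic to its complement G̅, yet G and G̅ have the same Tutte polynomial: for all real numbers x and y, Σ_{F ⊆ E(G)} (x−1)^{c(F)−c(E(G))}·(y−1)^{c(F)+|F|−|V(G)|} = Σ_{F ⊆ E(G̅)} (x−1)^{c(F)−c(E(G̅))}·(y−1)^{c(F)+|F|−|V(G)|}. -/

import Mathlib

open SimpleGraph

open scoped Classical

/-- `c(F)`: the number of connected components of the spanning subgraph `(V, F)`. -/

noncomputable def numComponents {V : Type*} [Fintype V] (F : Finset (Sym2 V)) : ℕ :=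
  Nat.card (SimpleGraph.fromEdgeSet (F : Set (Sym2 V))).ConnectedComponent

/-- The Tutte polynomial of `G`, evaluated at `(x, y)`:
`T_G(x,y) = Σ_{F ⊆ E(G)} (x−1)^(c(F)−c(E)) * (y−1)^(c(F)+|F|−|V|)`. -/

noncomputable def tutte {V : Type*} [Fintype V] (G : SimpleGraph V) (x y : ℝ) : ℝ :=
  ∑ F ∈ G.edgeFinset.powerset,
    (x - 1) ^ (numComponents F - numComponents G.edgeFinset) *
      (y - 1) ^ (numComponents F + F.card - Fintype.card V)

set_option linter.unusedSectionVars false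

noncomputable def dd {C R : Type*} [CommRing R] (t : R) (a b : C) : R := if a = b then t else 1

lemma dd_comm {C R : Type*} [CommRing R] (t : R) (a b : C) : dd t a b = dd t b a := by
  unfold dd; simp only [eq_comm]

lemma dd_self {C R : Type*} [CommRing R] (t : R) (a : C) : dd t a a = t := by
  simp [dd]

/-- the colour-weighted Potts sum -/
noncomputable def potts {V C R : Type*} [Fintype V] [DecidableEq V] [Fintype C] [CommRing R]
    (G : SimpleGraph V) (x : C → R) (t : R) : R :=
  ∑ f : V → C, (∏ v, x (f v)) * ∏ u, ∏ v, (if G.Adj u v then dd t (f u) (f v) else 1)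

lemma sum_reindex {C R : Type*} [Fintype C] [CommRing R] (p : Fin 8 → Fin 8)
    (hp : Function.Bijective p) (F : (Fin 8 → C) → R) :
    ∑ f : Fin 8 → C, F f = ∑ f : Fin 8 → C, F (fun i => f (p i)) := by
  have := Equiv.sum_comp (Equiv.arrowCongr (Equiv.ofBijective p hp).symm (Equiv.refl C)) F
  rw [← this]
  rfl

def baseRel (i j : Fin 8) : Bool :=
  (![![false, false, true, true, false, false, false, false],
    ![false, false, true, false, true, true, false, true],
    ![true, true, false, true, true, false, false, false],
    ![true, false, true, false, true, false, true, true],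
    ![false, true, true, true, false, true, false, true],
    ![false, true, false, false, true, false, true, false],
    ![false, false, false, true, false, true, false, false],
    ![false, true, false, true, true, false, false, false]] : Fin 8 → Fin 8 → Bool) i j

lemma baseRel_symm : ∀ i j, baseRel i j = baseRel j i := by decide
lemma baseRel_irrefl : ∀ i, baseRel i i = false := by decide

def baseG : SimpleGraph (Fin 8) where
  Adj i j := baseRel i j = true
  symm := ⟨fun i j h => by rw [baseRel_symm]; exact h⟩
  loopless := ⟨fun i h => by simp [baseRel_irrefl] at h⟩

section
variable {C R : Type*} [Fintype C] [CommRing R]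

/-- vertex weight monomial -/
noncomputable def wt (x : C → R) (f : Fin 8 → C) : R :=
  x (f 0) * x (f 1) * x (f 2) * x (f 3) * x (f 4) * x (f 5) * x (f 6) * x (f 7)

noncomputable def cEdges (t : R) (f : Fin 8 → C) : R :=
  dd t (f 0) (f 2) * dd t (f 0) (f 3) * dd t (f 1) (f 2) * dd t (f 1) (f 4) * dd t (f 1) (f 5) *
  dd t (f 1) (f 7) * dd t (f 2) (f 3) * dd t (f 2) (f 4) * dd t (f 3) (f 4) * dd t (f 3) (f 6) *
  dd t (f 4) (f 5) * dd t (f 4) (f 7) * dd t (f 5) (f 6)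

noncomputable def mEdges (t : R) (f : Fin 8 → C) : R :=
  dd t (f 0) (f 2) * dd t (f 0) (f 2) * dd t (f 0) (f 3) * dd t (f 0) (f 4) * dd t (f 0) (f 5) *
  dd t (f 0) (f 7) * dd t (f 2) (f 3) * dd t (f 2) (f 4) * dd t (f 3) (f 4) * dd t (f 3) (f 6) *
  dd t (f 4) (f 7) * dd t (f 5) (f 6)

noncomputable def kd (R : Type*) [CommRing R] (a b : C) : R := if a = b then 1 else 0

lemma dd_eq (t : R) (a b : C) : dd t a b = 1 + (t - 1) * kd R a b := by
  unfold dd kd; split_ifs <;> ring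

lemma key2 (x : C → R) (t : R) :
    ∑ f : Fin 8 → C, kd R (f 0) (f 1) * kd R (f 2) (f 6) * mEdges t f * wt x f =
    ∑ f : Fin 8 → C, kd R (f 0) (f 1) * kd R (f 4) (f 5) * mEdges t f * wt x f := by
  rw [sum_reindex ![4, 5, 0, 2, 3, 7, 1, 6] (by decide)]
  refine Finset.sum_congr rfl fun f _ => ?_
  simp only [mEdges, wt, Matrix.cons_val]
  generalize f 0 = a0, f 1 = a1, f 2 = a2, f 3 = a3, f 4 = a4, f 5 = a5, f 6 = a6, f 7 = a7
  by_cases h1 : a0 = a1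
  · by_cases h2 : a4 = a5
    · subst h1 h2
      rw [dd_comm t a4 a0, dd_comm t a4 a2, dd_comm t a4 a3, dd_comm t a2 a0,
        dd_comm t a7 a0]
      ring
    · simp [kd, h2]
  · simp [kd, h1]

lemma key1 (x : C → R) (t : R) :
    ∑ f : Fin 8 → C, kd R (f 3) (f 7) * cEdges t f * wt x f =
    ∑ f : Fin 8 → C, kd R (f 0) (f 1) * cEdges t f * wt x f := by
  have h1 : ∑ f : Fin 8 → C, kd R (f 3) (f 7) * cEdges t f * wt x f =
      ∑ f : Fin 8 → C, (kd R (f 0) (f 1) * mEdges t f * wt x f +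
        (t - 1) * (kd R (f 0) (f 1) * kd R (f 2) (f 6) * mEdges t f * wt x f)) := by
    rw [sum_reindex ![7, 3, 4, 0, 2, 6, 5, 1] (by decide)]
    refine Finset.sum_congr rfl fun f _ => ?_
    simp only [mEdges, cEdges, wt, Matrix.cons_val]
    generalize f 0 = a0, f 1 = a1, f 2 = a2, f 3 = a3, f 4 = a4, f 5 = a5, f 6 = a6, f 7 = a7
    by_cases h1 : a0 = a1
    · subst h1
      rw [dd_comm t a7 a4, dd_comm t a7 a0, dd_comm t a3 a2, dd_comm t a3 a0, dd_comm t a4 a0,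
        dd_comm t a4 a2, dd_comm t a2 a0, dd_comm t a6 a5, dd_eq t a2 a6]
      ring
    · simp [kd, h1]
  have h2 : ∑ f : Fin 8 → C, kd R (f 0) (f 1) * cEdges t f * wt x f =
      ∑ f : Fin 8 → C, (kd R (f 0) (f 1) * mEdges t f * wt x f +
        (t - 1) * (kd R (f 0) (f 1) * kd R (f 4) (f 5) * mEdges t f * wt x f)) := by
    refine Finset.sum_congr rfl fun f _ => ?_
    simp only [mEdges, cEdges, wt]
    generalize f 0 = a0, f 1 = a1, f 2 = a2, f 3 = a3, f 4 = a4, f 5 = a5, f 6 = a6, f 7 = a7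
    by_cases h1 : a0 = a1
    · subst h1
      rw [dd_eq t a4 a5]
      ring
    · simp [kd, h1]
  rw [h1, h2, Finset.sum_add_distrib, Finset.sum_add_distrib, ← Finset.mul_sum,
    ← Finset.mul_sum, key2]

lemma dd_sq (t : R) (a b : C) : dd (t ^ 2) a b = dd t a b ^ 2 := by
  unfold dd; split_ifs <;> simp

lemma base_left (x : C → R) (t : R) : potts baseG x t =
    ∑ f : Fin 8 → C, (cEdges (t ^ 2) f * wt x f +
      (t ^ 2 - 1) * (kd R (f 3) (f 7) * cEdges (t ^ 2) f * wt x f)) := by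
  unfold potts
  refine Finset.sum_congr rfl fun f _ => ?_
  have : cEdges (t ^ 2) f * wt x f +
      (t ^ 2 - 1) * (kd R (f 3) (f 7) * cEdges (t ^ 2) f * wt x f) =
      dd (t ^ 2) (f 3) (f 7) * cEdges (t ^ 2) f * wt x f := by
    rw [dd_eq _ (f 3)]; ring
  rw [this]
  simp only [Fin.prod_univ_eight, cEdges, wt, dd_sq, baseG, baseRel, Matrix.cons_val, if_true,
    reduceIte, Bool.false_eq_true, mul_one, one_mul]
  generalize f 0 = a0, f 1 = a1, f 2 = a2, f 3 = a3, f 4 = a4, f 5 = a5, f 6 = a6, f 7 = a7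
  rw [dd_comm t a2 a0, dd_comm t a3 a0, dd_comm t a2 a1, dd_comm t a4 a1, dd_comm t a5 a1,
    dd_comm t a7 a1, dd_comm t a3 a2, dd_comm t a4 a2, dd_comm t a4 a3, dd_comm t a6 a3,
    dd_comm t a5 a4, dd_comm t a7 a4, dd_comm t a6 a5, dd_comm t a7 a3]
  ring

lemma base_right (x : C → R) (t : R) : potts baseGᶜ x t =
    ∑ f : Fin 8 → C, (cEdges (t ^ 2) f * wt x f +
      (t ^ 2 - 1) * (kd R (f 0) (f 1) * cEdges (t ^ 2) f * wt x f)) := by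
  unfold potts
  rw [sum_reindex ![4, 5, 0, 6, 7, 3, 1, 2] (by decide)]
  refine Finset.sum_congr rfl fun f _ => ?_
  have : cEdges (t ^ 2) f * wt x f +
      (t ^ 2 - 1) * (kd R (f 0) (f 1) * cEdges (t ^ 2) f * wt x f) =
      dd (t ^ 2) (f 0) (f 1) * cEdges (t ^ 2) f * wt x f := by
    rw [dd_eq _ (f 0)]; ring
  rw [this]
  have hadj : ∀ i j, baseGᶜ.Adj i j ↔ (decide (i ≠ j) && !baseRel i j) = true := by
    intro i j; simp [baseG]
  simp only [hadj]
  simp (decide := true) only [Fin.prod_univ_eight, cEdges, wt, dd_sq, Matrix.cons_val, if_true, if_false,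
    mul_one, one_mul]
  generalize f 0 = a0, f 1 = a1, f 2 = a2, f 3 = a3, f 4 = a4, f 5 = a5, f 6 = a6, f 7 = a7
  rw [dd_comm t a2 a0, dd_comm t a3 a0, dd_comm t a2 a1, dd_comm t a4 a1, dd_comm t a5 a1,
    dd_comm t a7 a1, dd_comm t a3 a2, dd_comm t a4 a2, dd_comm t a4 a3, dd_comm t a6 a3,
    dd_comm t a5 a4, dd_comm t a7 a4, dd_comm t a6 a5, dd_comm t a1 a0]
  ring

lemma base_potts (x : C → R) (t : R) : potts baseG x t = potts baseGᶜ x t := by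
  rw [base_left, base_right, Finset.sum_add_distrib, Finset.sum_add_distrib, ← Finset.mul_sum,
    ← Finset.mul_sum, key1]
end

def compRel (i j : Fin 8) : Bool := decide (i ≠ j) && !baseRel i j

lemma comp_adj (i j : Fin 8) : baseGᶜ.Adj i j ↔ compRel i j = true := by
  simp [baseG, compRel]

def dgA (i : Fin 8) : ℕ := (Finset.univ.filter (fun j => baseRel i j = true)).card
def dgB (i : Fin 8) : ℕ := (Finset.univ.filter (fun j => compRel i j = true)).card

lemma base_not_iso : ¬ Nonempty (baseG ≃g baseGᶜ) := by
  rintro ⟨φ⟩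
  have hadj : ∀ i j, baseRel i j = true ↔ compRel (φ i) (φ j) = true := by
    intro i j
    rw [← comp_adj, φ.map_adj_iff]; rfl
  have hdeg : ∀ i, dgA i = dgB (φ i) := by
    intro i
    refine Finset.card_bijective φ φ.bijective fun j => ?_
    simp [hadj]
  have hB : ∃ v, dgB v = 2 ∧ ∀ w, compRel v w = true → dgB w = 5 := by decide
  have hA : ¬ ∃ v, dgA v = 2 ∧ ∀ w, baseRel v w = true → dgA w = 5 := by decide
  obtain ⟨v, hv, hw⟩ := hB
  refine hA ⟨φ.symm v, ?_, fun w h => ?_⟩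
  · rw [hdeg]; simpa using hv
  · rw [hdeg]; apply hw; rw [hadj] at h; simpa using h

lemma potts_iso {V W C R : Type*} [Fintype V] [DecidableEq V] [Fintype W] [DecidableEq W]
    [Fintype C] [CommRing R] {G : SimpleGraph V} {H : SimpleGraph W} (φ : G ≃g H)
    (x : C → R) (t : R) : potts G x t = potts H x t := by
  unfold potts
  rw [← Equiv.sum_comp (Equiv.arrowCongr φ.toEquiv.symm (Equiv.refl C))]
  refine Finset.sum_congr rfl fun f _ => ?_
  congr 1
  · rw [← Equiv.prod_comp φ.toEquiv]
    rfl
  · rw [← Equiv.prod_comp φ.toEquiv]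
    refine Finset.prod_congr rfl fun u _ => ?_
    rw [← Equiv.prod_comp φ.toEquiv]
    refine Finset.prod_congr rfl fun v _ => ?_
    have : H.Adj (φ.toEquiv u) (φ.toEquiv v) ↔ G.Adj u v := φ.map_adj_iff
    simp only [this]
    rfl

def pathRel (i j : Fin 4) : Bool :=
  (![![false, true, false, false], ![true, false, true, false],
    ![false, true, false, true], ![false, false, true, false]] : Fin 4 → Fin 4 → Bool) i j

def midRel (i : Fin 4) : Bool := (![false, true, true, false] : Fin 4 → Bool) i

def extRel {V : Type*} (G : SimpleGraph V) : V ⊕ Fin 4 → V ⊕ Fin 4 → Prop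
  | Sum.inl u, Sum.inl v => G.Adj u v
  | Sum.inl _, Sum.inr j => midRel j = true
  | Sum.inr i, Sum.inl _ => midRel i = true
  | Sum.inr i, Sum.inr j => pathRel i j = true

/-- add a path `0-1-2-3` whose middle vertices are joined to everything in `G` -/
def extG {V : Type*} (G : SimpleGraph V) : SimpleGraph (V ⊕ Fin 4) where
  Adj := extRel G
  symm := ⟨by
    have h : ∀ i j, pathRel i j = true → pathRel j i = true := by decide
    rintro (u | i) (v | j) H
    · exact G.adj_symm H
    · exact H
    · exact H
    · exact h _ _ H⟩
  loopless := ⟨by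
    have h : ∀ i, ¬ pathRel i i = true := by decide
    rintro (u | i) H
    · exact G.loopless.irrefl u H
    · exact h _ H⟩

def rot : Fin 4 ≃ Fin 4 where
  toFun := ![1, 3, 0, 2]
  invFun := ![2, 0, 3, 1]
  left_inv := by decide
  right_inv := by decide

def extCompl {V : Type*} (G : SimpleGraph V) : extG Gᶜ ≃g (extG G)ᶜ where
  toEquiv := Equiv.sumCongr (Equiv.refl V) rot
  map_rel_iff' := by
    have h1 : ∀ i, midRel i = true ↔ ¬ midRel (rot i) = true := by decide
    have h2 : ∀ i j, pathRel i j = true ↔ rot i ≠ rot j ∧ ¬ pathRel (rot i) (rot j) = true := by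
      decide
    rintro (u | i) (v | j)
    · simp [extG, extRel]
    · simp [extG, extRel, h1 j]
    · simp [extG, extRel, h1 i]
    · simp only [compl_adj]
      exact Iff.trans (by simp [extG, extRel]) (h2 i j).symm

lemma ext_potts {V C R : Type*} [Fintype V] [DecidableEq V]
    [Fintype C] [CommRing R] (G : SimpleGraph V) (x : C → R) (t : R) :
    potts (extG G) x t = ∑ g : Fin 4 → C,
      (∏ i, x (g i)) * (∏ i, ∏ j, if pathRel i j = true then dd t (g i) (g j) else 1) *
      potts G (fun c => x c * ∏ i, if midRel i = true then dd t c (g i) ^ 2 else 1) t := by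
  unfold potts
  rw [← Equiv.sum_comp (Equiv.sumArrowEquivProdArrow V (Fin 4) C).symm, Fintype.sum_prod_type_right]
  refine Finset.sum_congr rfl fun g _ => ?_
  rw [Finset.mul_sum]
  refine Finset.sum_congr rfl fun f _ => ?_
  have e1 : ∀ v, (Equiv.sumArrowEquivProdArrow V (Fin 4) C).symm (f, g) (Sum.inl v) = f v :=
    fun _ => rfl
  have e2 : ∀ v, (Equiv.sumArrowEquivProdArrow V (Fin 4) C).symm (f, g) (Sum.inr v) = g v :=
    fun _ => rfl
  have a1 : ∀ u v, (extG G).Adj (Sum.inl u) (Sum.inl v) ↔ G.Adj u v := fun _ _ => Iff.rfl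
  have a2 : ∀ u j, (extG G).Adj (Sum.inl u) (Sum.inr j) ↔ midRel j = true := fun _ _ => Iff.rfl
  have a3 : ∀ i v, (extG G).Adj (Sum.inr i) (Sum.inl v) ↔ midRel i = true := fun _ _ => Iff.rfl
  have a4 : ∀ i j, (extG G).Adj (Sum.inr i) (Sum.inr j) ↔ pathRel i j = true := fun _ _ => Iff.rfl
  simp only [Fintype.prod_sum_type, e1, e2, a1, a2, a3, a4, Finset.prod_mul_distrib]
  have e3 : (∏ v, ∏ i, if midRel i = true then dd t (f v) (g i) ^ 2 else 1) =
      (∏ v, ∏ i, if midRel i = true then dd t (f v) (g i) else 1) *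
      (∏ i, ∏ v, if midRel i = true then dd t (g i) (f v) else 1) := by
    rw [Finset.prod_comm (s := (Finset.univ : Finset (Fin 4))), ← Finset.prod_mul_distrib]
    refine Finset.prod_congr rfl fun v _ => ?_
    rw [← Finset.prod_mul_distrib]
    refine Finset.prod_congr rfl fun i _ => ?_
    rw [dd_comm t (g i)]
    split_ifs <;> ring
  rw [e3]
  ring

def Pendant {V : Type*} (G : SimpleGraph V) (u : V) : Prop :=
  ∀ v w, G.Adj u v → G.Adj u w → v = w

def Outer {V : Type*} (G : SimpleGraph V) (u : V) : Prop :=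
  Pendant G u ∨ ∃ p, Pendant G p ∧ G.Adj p u

lemma pendant_iso {V W : Type*} {G : SimpleGraph V} {H : SimpleGraph W} (φ : G ≃g H) (u : V)
    (h : Pendant G u) : Pendant H (φ u) := by
  intro v w hv hw
  have := h (φ.symm v) (φ.symm w) (by rw [← φ.map_adj_iff]; simpa using hv)
    (by rw [← φ.map_adj_iff]; simpa using hw)
  exact φ.symm.injective this

lemma outer_iso {V W : Type*} {G : SimpleGraph V} {H : SimpleGraph W} (φ : G ≃g H) (u : V)
    (h : Outer G u) : Outer H (φ u) := by
  rcases h with h | ⟨p, hp, ha⟩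
  · exact Or.inl (pendant_iso φ u h)
  · exact Or.inr ⟨φ p, pendant_iso φ p hp, φ.map_adj_iff.2 ha⟩

lemma not_pendant_inl {V : Type*} (G : SimpleGraph V) (v : V) :
    ¬ Pendant (extG G) (Sum.inl v) := by
  intro h
  have := h (Sum.inr 1) (Sum.inr 2) (show midRel 1 = true by decide)
    (show midRel 2 = true by decide)
  simp at this

lemma pendant_inr {V : Type*} (G : SimpleGraph V) (i : Fin 4) (h : midRel i = false) :
    Pendant (extG G) (Sum.inr i) := by
  have h2 : ∀ i j k, midRel i = false → pathRel i j = true → pathRel i k = true → j = k := by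
    decide
  rintro (v | j) (w | k) hv hw
  · exact absurd (show midRel i = true from hv) (by simp [h])
  · exact absurd (show midRel i = true from hv) (by simp [h])
  · exact absurd (show midRel i = true from hw) (by simp [h])
  · rw [h2 i j k h hv hw]

lemma not_pendant_mid {V : Type*} (G : SimpleGraph V) (i : Fin 4) (h : midRel i = true) :
    ¬ Pendant (extG G) (Sum.inr i) := by
  have h2 : ∀ i, midRel i = true → ∃ j k, pathRel i j = true ∧ pathRel i k = true ∧ j ≠ k := by
    decide
  obtain ⟨j, k, hj, hk, hne⟩ := h2 i h
  intro hp
  exact hne (Sum.inr_injective (hp (Sum.inr j) (Sum.inr k) hj hk))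

lemma outer_inr {V : Type*} (G : SimpleGraph V) (i : Fin 4) : Outer (extG G) (Sum.inr i) := by
  have h2 : ∀ i, midRel i = true → ∃ j, midRel j = false ∧ pathRel j i = true := by decide
  by_cases h : midRel i = true
  · obtain ⟨j, hj, hji⟩ := h2 i h
    exact Or.inr ⟨Sum.inr j, pendant_inr G j hj, hji⟩
  · exact Or.inl (pendant_inr G i (by simpa using h))

lemma not_outer_inl {V : Type*} (G : SimpleGraph V) (v : V) :
    ¬ Outer (extG G) (Sum.inl v) := by
  rintro (h | ⟨p | i, hp, ha⟩)
  · exact not_pendant_inl G v h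
  · exact not_pendant_inl G p hp
  · exact not_pendant_mid G i ha hp

lemma ext_inl {V W : Type*} {G : SimpleGraph V} {H : SimpleGraph W} (φ : extG G ≃g extG H)
    (v : V) : ∃ w, φ (Sum.inl v) = Sum.inl w := by
  rcases h : φ (Sum.inl v) with w | i
  · exact ⟨w, rfl⟩
  · exfalso
    have := outer_iso φ.symm _ (outer_inr H i)
    rw [← h] at this
    exact not_outer_inl G v (by simpa using this)

lemma ext_cancel {V W : Type*} {G : SimpleGraph V} {H : SimpleGraph W} (φ : extG G ≃g extG H) :
    Nonempty (G ≃g H) := by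
  choose f hf using ext_inl φ
  choose g hg using ext_inl φ.symm
  refine ⟨⟨⟨f, g, fun v => ?_, fun w => ?_⟩, fun {a b} => ?_⟩⟩
  · apply Sum.inl_injective (β := Fin 4)
    rw [← hg, ← hf]; simp
  · apply Sum.inl_injective (β := Fin 4)
    rw [← hf, ← hg]; simp
  · have := φ.map_adj_iff (v := Sum.inl a) (w := Sum.inl b)
    rw [hf, hf] at this
    exact this

def PottsEq {V W : Type*} [Fintype V] [DecidableEq V] [Fintype W] [DecidableEq W]
    (G : SimpleGraph V) (H : SimpleGraph W) : Prop :=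
  ∀ (q : ℕ) (x : Fin q → Polynomial ℝ), potts G x Polynomial.X = potts H x Polynomial.X

/-- the subgraph of monochromatic edges -/
def monoG {V C : Type*} (G : SimpleGraph V) (f : V → C) : SimpleGraph V where
  Adj u v := G.Adj u v ∧ f u = f v
  symm := ⟨fun _ _ h => ⟨h.1.symm, h.2.symm⟩⟩
  loopless := ⟨fun v h => G.loopless.irrefl v h.1⟩

lemma prod_mono {V C : Type*} [Fintype V] [DecidableEq V] (G : SimpleGraph V) (f : V → C) :
    (∏ u, ∏ v, (if G.Adj u v then dd (Polynomial.X : Polynomial ℝ) (f u) (f v) else 1)) =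
    Polynomial.X ^ (2 * (monoG G f).edgeFinset.card) := by
  rw [← sum_degrees_eq_twice_card_edges, ← Finset.prod_pow_eq_pow_sum]
  refine Finset.prod_congr rfl fun u _ => ?_
  have : ∀ v, (if G.Adj u v then dd (Polynomial.X : Polynomial ℝ) (f u) (f v) else 1) =
      if (monoG G f).Adj u v then (Polynomial.X : Polynomial ℝ) else 1 := by
    intro v
    unfold dd monoG
    by_cases h1 : G.Adj u v <;> by_cases h2 : f u = f v <;> simp [h1, h2]
  simp only [this]
  rw [Finset.prod_ite, Finset.prod_const, Finset.prod_const_one, mul_one]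
  congr 1
  rw [← card_neighborFinset_eq_degree]
  congr 1
  ext v
  simp

/-- from equality of `∑ X ^ d` to equality of `∑ φ d` -/
lemma sum_of_X_pow {ι κ : Type*} (s : Finset ι) (r : Finset κ) (d : ι → ℕ) (e : κ → ℕ)
    (h : ∑ i ∈ s, (Polynomial.X : Polynomial ℝ) ^ d i = ∑ j ∈ r, Polynomial.X ^ e j)
    (φ : ℕ → ℝ) : ∑ i ∈ s, φ (d i) = ∑ j ∈ r, φ (e j) := by
  have key := congrArg (Polynomial.lsum (fun n => (φ n) • (LinearMap.id : ℝ →ₗ[ℝ] ℝ))) h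
  simpa [map_sum, Polynomial.lsum_apply, ← Polynomial.monomial_one_right_eq_X_pow,
    Polynomial.sum_monomial_index] using key

lemma card_colorings {V : Type*} [Fintype V] [DecidableEq V] (F : Finset (Sym2 V)) (q : ℕ) :
    (Finset.univ.filter (fun f : V → Fin q =>
      ∀ u v, (fromEdgeSet (F : Set (Sym2 V))).Adj u v → f u = f v)).card =
      q ^ numComponents F := by
  set Γ := fromEdgeSet (F : Set (Sym2 V)) with hΓ
  let e : {f : V → Fin q // ∀ u v, Γ.Adj u v → f u = f v} ≃ (Γ.ConnectedComponent → Fin q) :=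
    { toFun := fun f => fun c => c.lift f.1 (by
        intro v w p _
        induction p with
        | nil => rfl
        | cons h _ ih => exact (f.2 _ _ h).trans (ih (by simp_all [Walk.isPath_def])))
      invFun := fun g => ⟨fun v => g (Γ.connectedComponentMk v), fun u v h => by
        exact congrArg g (ConnectedComponent.connectedComponentMk_eq_of_adj h)⟩
      left_inv := fun f => by ext v; rfl
      right_inv := fun g => by
        funext c
        induction c using ConnectedComponent.ind with
        | h v => rfl }
  rw [← Fintype.card_subtype, Fintype.card_congr e, Fintype.card_fun, Fintype.card_fin,
    numComponents, Nat.card_eq_fintype_card]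

lemma sum_choose {V : Type*} [Fintype V] [DecidableEq V] (G : SimpleGraph V) (q m : ℕ) :
    ∑ f : V → Fin q, ((monoG G f).edgeFinset.card).choose m =
    ∑ F ∈ G.edgeFinset.powersetCard m, q ^ numComponents F := by
  have h1 : ∀ f : V → Fin q, ((monoG G f).edgeFinset.card).choose m =
      ∑ F ∈ G.edgeFinset.powersetCard m,
        if (∀ u v, (fromEdgeSet (F : Set (Sym2 V))).Adj u v → f u = f v) then 1 else 0 := by
    intro f
    rw [← Finset.card_powersetCard, ← Finset.card_filter]
    congr 1
    ext F
    simp only [Finset.mem_filter, Finset.mem_powersetCard]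
    constructor
    · rintro ⟨hF, hm⟩
      refine ⟨⟨fun e he => ?_, hm⟩, fun u v huv => ?_⟩
      · have := hF he
        induction e using Sym2.ind with
        | h a b =>
          rw [mem_edgeFinset, mem_edgeSet] at this ⊢
          exact this.1
      · rw [fromEdgeSet_adj] at huv
        have := hF (by simpa using huv.1)
        rw [mem_edgeFinset, mem_edgeSet] at this
        exact this.2
    · rintro ⟨⟨hF, hm⟩, hc⟩
      refine ⟨fun e he => ?_, hm⟩
      have := hF he
      induction e using Sym2.ind with
      | h a b =>
        rw [mem_edgeFinset, mem_edgeSet] at this ⊢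
        refine ⟨this, hc a b ?_⟩
        rw [fromEdgeSet_adj]
        exact ⟨by simpa using he, this.ne⟩
  simp only [h1]
  rw [Finset.sum_comm]
  refine Finset.sum_congr rfl fun F _ => ?_
  rw [← card_colorings, Finset.card_filter]

lemma PottsEq.sums {V : Type*} [Fintype V] [DecidableEq V] {G H : SimpleGraph V}
    (h : PottsEq G H) (m : ℕ) (φ : ℕ → ℝ) :
    ∑ F ∈ G.edgeFinset.powersetCard m, φ (numComponents F) =
    ∑ F ∈ H.edgeFinset.powersetCard m, φ (numComponents F) := by
  apply sum_of_X_pow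
  apply Polynomial.eq_of_infinite_eval_eq
  refine Set.Infinite.mono ?_ (Set.infinite_range_of_injective (Nat.cast_injective (R := ℝ)))
  rintro _ ⟨q, rfl⟩
  have h1 := h q (fun _ => 1)
  unfold potts at h1
  simp only [prod_mono, Finset.prod_const_one, one_mul] at h1
  have h2 := sum_of_X_pow _ _ _ _ h1 (fun d => (((d / 2).choose m : ℕ) : ℝ))
  have h3 : ∀ k : ℕ, 2 * k / 2 = k := fun k => by omega
  simp only [h3] at h2
  have h4 := sum_choose G q m
  have h5 := sum_choose H q m
  rw [← Nat.cast_sum, ← Nat.cast_sum, h4, h5] at h2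
  simpa [Polynomial.eval_finsetSum] using h2

lemma PottsEq.tutte_eq {V : Type*} [Fintype V] [DecidableEq V] {G H : SimpleGraph V}
    (h : PottsEq G H) (x y : ℝ) : tutte G x y = tutte H x y := by
  have hE : G.edgeFinset.card = H.edgeFinset.card := by
    have := h.sums 1 (fun _ => 1)
    simpa using this
  have hc : numComponents G.edgeFinset = numComponents H.edgeFinset := by
    have := h.sums G.edgeFinset.card (fun n => (n : ℝ))
    rw [Finset.powersetCard_self, hE, Finset.powersetCard_self] at this
    simpa using this
  unfold _root_.tutte
  rw [Finset.sum_powerset, Finset.sum_powerset, hE, hc]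
  refine Finset.sum_congr rfl fun m _ => ?_
  have := h.sums m (fun n => (x - 1) ^ (n - numComponents H.edgeFinset) *
      (y - 1) ^ (n + m - Fintype.card V))
  refine Eq.trans (Finset.sum_congr rfl fun F hF => ?_) (this.trans
    (Finset.sum_congr rfl fun F hF => ?_))
  · rw [(Finset.mem_powersetCard.1 hF).2]
  · rw [(Finset.mem_powersetCard.1 hF).2]

lemma exists_chain (k : ℕ) : ∃ (V : Type) (_ : Fintype V) (_ : DecidableEq V)
    (G : SimpleGraph V), Fintype.card V > k ∧ ¬ Nonempty (G ≃g Gᶜ) ∧ PottsEq G Gᶜ := by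
  induction k with
  | zero => exact ⟨Fin 8, inferInstance, inferInstance, baseG, by simp, base_not_iso,
      fun q x => base_potts x _⟩
  | succ k ih =>
    obtain ⟨V, i1, i2, G, hV, hiso, hP⟩ := ih
    refine ⟨V ⊕ Fin 4, inferInstance, inferInstance, extG G, ?_, ?_, fun q x => ?_⟩
    · simp only [Fintype.card_sum, Fintype.card_fin]; omega
    · rintro ⟨φ⟩
      exact hiso (ext_cancel (φ.trans (extCompl G).symm))
    · rw [← potts_iso (extCompl G), ext_potts, ext_potts]
      refine Finset.sum_congr rfl fun g _ => ?_
      rw [hP]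

lemma exists_fin (N : ℕ) : ∃ (n : ℕ) (G : SimpleGraph (Fin n)),
    n > N ∧ ¬ Nonempty (G ≃g Gᶜ) ∧ PottsEq G Gᶜ := by
  obtain ⟨V, i1, i2, G, hV, hiso, hP⟩ := exists_chain N
  let e := Fintype.equivFin V
  let φ : G.comap e.symm ≃g G := Iso.comap e.symm G
  let ψ : (G.comap e.symm)ᶜ ≃g Gᶜ :=
    ⟨e.symm, by intro a b; simp⟩
  refine ⟨_, G.comap e.symm, hV, ?_, fun q x => ?_⟩
  · rintro ⟨θ⟩
    exact hiso ⟨(φ.symm.trans θ).trans ψ⟩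
  · rw [potts_iso φ, potts_iso ψ, hP]

/-- For every `N` there is a graph on more than `N` vertices that is not isomorphic to its
complement but has the same Tutte polynomial as its complement. -/
theorem stmt_10 (N : ℕ) :
    ∃ (n : ℕ) (G : SimpleGraph (Fin n)),
      n > N ∧ ¬ Nonempty (G ≃g Gᶜ) ∧ ∀ x y : ℝ, tutte G x y = tutte Gᶜ x y := by
  obtain ⟨n, G, hn, hiso, hP⟩ := exists_fin N
  exact ⟨n, G, hn, hiso, fun x y => hP.tutte_eq x y⟩
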